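/- Let U be a unitary matrix on the bipartite space ℂ^{d_A} ⊗ ℂ^{d_B} (indexed by Fin d_A × Fin d_B) and let σ be a density matrix on ℂ^{d_B}. Then the following three conditions are equivalent: (i) there exists a unitary V on ℂ^{d_B} such that Tr_A(U(ρ ⊗ σ)U†) = VσV† for every density matrix ρ on ℂ^{d_A}; (ii) for every density matrix ρ on ℂ^{d_A} there exists a unitary W_ρ on ℂ^{d_B} such that Tr_A(U(ρ ⊗ σ)U†) = W_ρ σ W_ρ†; (iii) there exists a density matrix ξ on ℂ^{d_B} such that Tr_A(U(ρ ⊗ σ)U†) = ξ for every density matrix ρ on ℂ^{d_A}. -/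

import Mathlib

open scoped Matrix Kronecker BigOperators Classical ComplexOrder

/-- A density matrix: positive semidefinite with unit trace. -/
noncomputable def IsDensity {n : Type*} [Fintype n] (ρ : Matrix n n ℂ) : Prop :=
  ρ.PosSemidef ∧ ρ.trace = 1

/-- A unitary matrix. -/
noncomputable def IsUnitary {n : Type*} [Fintype n] [DecidableEq n] (U : Matrix n n ℂ) : Prop :=
  U * Uᴴ = 1 ∧ Uᴴ * U = 1

/-- Partial trace over the first tensor factor. -/
noncomputable def trFst {α β : Type*} [Fintype α] (M : Matrix (α × β) (α × β) ℂ) : Matrix β β ℂ :=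
  Matrix.of fun k l => ∑ i, M (i, k) (i, l)

/-- Partial trace over the second tensor factor. -/
noncomputable def trSnd {α β : Type*} [Fintype β] (M : Matrix (α × β) (α × β) ℂ) : Matrix α α ℂ :=
  Matrix.of fun i j => ∑ k, M (i, k) (j, k)

/-- Partial trace over the third factor of a tripartite system. -/
noncomputable def trThird {α β γ : Type*} [Fintype γ] (M : Matrix (α × β × γ) (α × β × γ) ℂ) :
    Matrix (α × β) (α × β) ℂ :=
  Matrix.of fun p q => ∑ k, M (p.1, p.2, k) (q.1, q.2, k)

/-- von Neumann entropy (base-2), with the convention `0 log 0 = 0`. -/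
noncomputable def vnEntropy {n : Type*} [Fintype n] [DecidableEq n] (ρ : Matrix n n ℂ) : ℝ :=
  if h : ρ.IsHermitian then -∑ i, h.eigenvalues i * Real.logb 2 (h.eigenvalues i) else 0

/-- Largest eigenvalue of a (Hermitian) matrix. -/
noncomputable def maxEig {n : Type*} [Fintype n] [DecidableEq n] (ρ : Matrix n n ℂ) : ℝ :=
  if h : ρ.IsHermitian then ⨆ i, h.eigenvalues i else 0

/-- Min-entropy of a density matrix. -/
noncomputable def minEntropy {n : Type*} [Fintype n] [DecidableEq n] (ρ : Matrix n n ℂ) : ℝ :=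
  -Real.logb 2 (maxEig ρ)

/-- Rényi entropy of order `α` (base 2). -/
noncomputable def renyiEntropy {n : Type*} [Fintype n] [DecidableEq n] (α : ℝ)
    (ρ : Matrix n n ℂ) : ℝ :=
  if h : ρ.IsHermitian then (1 - α)⁻¹ * Real.logb 2 (∑ i, h.eigenvalues i ^ α) else 0

/-- Partial transpose over the first tensor factor. -/
noncomputable def ptFst {α β : Type*} (U : Matrix (α × β) (α × β) ℂ) : Matrix (α × β) (α × β) ℂ :=
  Matrix.of fun p q => U (q.1, p.2) (p.1, q.2)

/-- Swap the two parties of a bipartite matrix. -/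
noncomputable def swapParties {α β : Type*} (U : Matrix (α × β) (α × β) ℂ) : Matrix (β × α) (β × α) ℂ :=
  Matrix.of fun p q => U (p.2, p.1) (q.2, q.1)

/-- `U` is compatible with the catalyst `σ`: there is a unitary `V` on `B` such that
`Tr_A (U (ρ ⊗ σ) U†) = V σ V†` for every density matrix `ρ` on `A`. -/
noncomputable def Compatible {dA dB : ℕ} (U : Matrix (Fin dA × Fin dB) (Fin dA × Fin dB) ℂ)
    (σ : Matrix (Fin dB) (Fin dB) ℂ) : Prop :=
  ∃ V : Matrix (Fin dB) (Fin dB) ℂ, IsUnitary V ∧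
    ∀ ρ : Matrix (Fin dA) (Fin dA) ℂ, IsDensity ρ →
      trFst (U * (ρ ⊗ₖ σ) * Uᴴ) = V * σ * Vᴴ

/-- The unitary `1_m ⊗ U` on `ℂ^m ⊗ ℂ^{dA} ⊗ ℂ^{dB}`, indexed as `(Fin m × Fin dA) × Fin dB`. -/
noncomputable def extUnitary {m dA dB : ℕ} (U : Matrix (Fin dA × Fin dB) (Fin dA × Fin dB) ℂ) :
    Matrix ((Fin m × Fin dA) × Fin dB) ((Fin m × Fin dA) × Fin dB) ℂ :=
  Matrix.of fun p q => if p.1.1 = q.1.1 then U (p.1.2, p.2) (q.1.2, q.2) else 0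

theorem trace_mul_one_kron {α β : Type*} [Fintype α] [Fintype β] [DecidableEq α]
    (P : Matrix (α × β) (α × β) ℂ) (Q : Matrix β β ℂ) :
    (P * ((1 : Matrix α α ℂ) ⊗ₖ Q)).trace = (trFst P * Q).trace := by
  simp only [Matrix.trace, Matrix.diag, Matrix.mul_apply, Fintype.sum_prod_type, trFst,
    Matrix.of_apply, Matrix.kroneckerMap_apply, Matrix.one_apply, Finset.sum_mul]
  simp only [ite_mul, one_mul, zero_mul, mul_ite, mul_zero]
  rw [Finset.sum_comm]
  refine Finset.sum_congr rfl fun k _ => ?_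
  rw [Finset.sum_comm (s := (Finset.univ : Finset β))]
  refine Finset.sum_congr rfl fun i _ => ?_
  rw [Finset.sum_comm]
  simp

theorem herm_sq_nonneg {n : Type*} [Fintype n] {H : Matrix n n ℂ} (h : H.IsHermitian) :
    0 ≤ (H * H).trace := by
  have := (Matrix.posSemidef_conjTranspose_mul_self H).trace_nonneg
  rwa [h.eq] at this

theorem herm_sq_zero {n : Type*} [Fintype n] {H : Matrix n n ℂ} (h : H.IsHermitian)
    (h0 : (H * H).trace = 0) : H = 0 := by
  apply Matrix.trace_conjTranspose_mul_self_eq_zero_iff.1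
  rwa [h.eq]

theorem one_kron_herm {α β : Type*} [Fintype α] [Fintype β] [DecidableEq α]
    {Q : Matrix β β ℂ} (h : Q.IsHermitian) : ((1 : Matrix α α ℂ) ⊗ₖ Q).IsHermitian := by
  unfold Matrix.IsHermitian
  rw [Matrix.conjTranspose_kronecker, h.eq, Matrix.conjTranspose_one]

theorem sq_expand {α β : Type*} [Fintype α] [Fintype β] [DecidableEq α]
    (P : Matrix (α × β) (α × β) ℂ) (Q : Matrix β β ℂ) :
    ((P - (1 : Matrix α α ℂ) ⊗ₖ Q) * (P - (1 : Matrix α α ℂ) ⊗ₖ Q)).trace =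
      (P * P).trace - 2 * (trFst P * Q).trace + Fintype.card α * (Q * Q).trace := by
  rw [Matrix.sub_mul, Matrix.mul_sub, Matrix.mul_sub, ← Matrix.mul_kronecker_mul,
    Matrix.trace_sub, Matrix.trace_sub, Matrix.trace_sub, Matrix.trace_mul_comm (_ ⊗ₖ _) P,
    trace_mul_one_kron, Matrix.trace_kronecker, Matrix.mul_one, Matrix.trace_one]
  ring

noncomputable def chan {α β : Type*} [Fintype α] [Fintype β]
    (U : Matrix (α × β) (α × β) ℂ) (σ : Matrix β β ℂ) : Matrix α α ℂ →ₗ[ℂ] Matrix β β ℂ where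
  toFun X := trFst (U * (X ⊗ₖ σ) * Uᴴ)
  map_add' X Y := by
    rw [Matrix.add_kronecker, Matrix.mul_add, Matrix.add_mul]
    ext; simp [trFst, Finset.sum_add_distrib]
  map_smul' c X := by
    rw [Matrix.smul_kronecker, Matrix.mul_smul, Matrix.smul_mul]
    ext; simp [trFst, Finset.mul_sum]

open scoped MatrixOrder Matrix.Norms.L2Operator in
theorem span_psd {n : Type*} [Fintype n] [DecidableEq n] :
    Submodule.span ℂ {A : Matrix n n ℂ | A.PosSemidef} = ⊤ := by
  have := CStarAlgebra.span_nonneg (A := Matrix n n ℂ)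
  simpa only [Matrix.nonneg_iff_posSemidef] using this

open scoped MatrixOrder Matrix.Norms.L2Operator in
theorem psd_fact {n : Type*} [Fintype n] [DecidableEq n] {A : Matrix n n ℂ} (h : A.PosSemidef) :
    ∃ S : Matrix n n ℂ, A = Sᴴ * S :=
  CStarAlgebra.nonneg_iff_eq_star_mul_self.1 (Matrix.nonneg_iff_posSemidef.2 h)

theorem chan_const {α β : Type*} [Fintype α] [Fintype β] [DecidableEq α]
    (F : Matrix α α ℂ →ₗ[ℂ] Matrix β β ℂ) (ξ : Matrix β β ℂ)
    (h : ∀ ρ, IsDensity ρ → F ρ = ξ) (X : Matrix α α ℂ) : F X = X.trace • ξ := by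
  have hX : X ∈ Submodule.span ℂ {A : Matrix α α ℂ | A.PosSemidef} := by
    rw [span_psd]; trivial
  induction hX using Submodule.span_induction with
  | mem x hx =>
    have hx : x.PosSemidef := hx
    by_cases h0 : x.trace = 0
    · rw [h0, hx.trace_eq_zero_iff.1 h0]; simp
    · have := h (x.trace⁻¹ • x) ⟨hx.smul (inv_nonneg.2 hx.trace_nonneg), by
        rw [Matrix.trace_smul, smul_eq_mul, inv_mul_cancel₀ h0]⟩
      rw [← this, map_smul, smul_smul, mul_inv_cancel₀ h0, one_smul]
  | zero => simp
  | add x y _ _ hx hy => rw [map_add, hx, hy, Matrix.trace_add, add_smul]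
  | smul c x _ hx => rw [map_smul, hx, Matrix.trace_smul, smul_smul, smul_eq_mul]

theorem pur_conj {n : Type*} [Fintype n] [DecidableEq n] {W σ : Matrix n n ℂ}
    (hW : IsUnitary W) : ((W * σ * Wᴴ) * (W * σ * Wᴴ)).trace = (σ * σ).trace := by
  have : (W * σ * Wᴴ) * (W * σ * Wᴴ) = W * (σ * (Wᴴ * W) * σ) * Wᴴ := by
    simp only [Matrix.mul_assoc]
  rw [this, hW.2, Matrix.trace_mul_cycle, ← Matrix.mul_assoc, hW.2]
  simp

theorem unit_equiv {n : Type*} [Fintype n] [DecidableEq n] {A B : Matrix n n ℂ}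
    (hA : A.IsHermitian) (hB : B.IsHermitian) (h : A.charpoly = B.charpoly) :
    ∃ V : Matrix n n ℂ, IsUnitary V ∧ B = V * A * Vᴴ := by
  have he := (Matrix.IsHermitian.eigenvalues_eq_eigenvalues_iff hA hB).2 h
  have h1 := hA.spectral_theorem
  have h2 := hB.spectral_theorem
  rw [Unitary.conjStarAlgAut_apply] at h1 h2
  rw [← he] at h2
  set D : Matrix n n ℂ := Matrix.diagonal (RCLike.ofReal ∘ hA.eigenvalues)
  set P := hA.eigenvectorUnitary
  set Q := hB.eigenvectorUnitary
  have p1 : (P : Matrix n n ℂ)ᴴ * P = 1 := Unitary.coe_star_mul_self P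
  have p2 : (P : Matrix n n ℂ) * (P : Matrix n n ℂ)ᴴ = 1 := Unitary.coe_mul_star_self P
  have q1 : (Q : Matrix n n ℂ)ᴴ * Q = 1 := Unitary.coe_star_mul_self Q
  have q2 : (Q : Matrix n n ℂ) * (Q : Matrix n n ℂ)ᴴ = 1 := Unitary.coe_mul_star_self Q
  rw [Matrix.star_eq_conjTranspose] at h1 h2
  generalize (P : Matrix n n ℂ) = p at *
  generalize (Q : Matrix n n ℂ) = q at *
  refine ⟨q * pᴴ, ⟨?_, ?_⟩, ?_⟩
  · rw [Matrix.conjTranspose_mul, Matrix.conjTranspose_conjTranspose, Matrix.mul_assoc,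
      ← Matrix.mul_assoc pᴴ, p1, Matrix.one_mul, q2]
  · rw [Matrix.conjTranspose_mul, Matrix.conjTranspose_conjTranspose, Matrix.mul_assoc,
      ← Matrix.mul_assoc qᴴ, q1, Matrix.one_mul, p2]
  · rw [Matrix.conjTranspose_mul, Matrix.conjTranspose_conjTranspose]
    have : q * pᴴ * A * (p * qᴴ) = q * ((pᴴ * p) * D * (pᴴ * p)) * qᴴ := by
      rw [h1]; simp only [Matrix.mul_assoc]
    rw [this, p1, Matrix.one_mul, Matrix.mul_one, h2]

theorem charpoly_one_kron {α β : Type*} [Fintype α] [Fintype β] [DecidableEq α] [DecidableEq β]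
    (Q : Matrix β β ℂ) :
    ((1 : Matrix α α ℂ) ⊗ₖ Q).charpoly = Q.charpoly ^ Fintype.card α := by
  have : ((1 : Matrix α α ℂ) ⊗ₖ Q).charmatrix =
      (1 : Matrix α α (Polynomial ℂ)) ⊗ₖ Q.charmatrix := by
    ext ⟨i, k⟩ ⟨j, l⟩
    by_cases h : i = j
    · subst h
      by_cases h' : k = l
      · subst h'; simp [Matrix.charmatrix_apply]
      · simp [Matrix.charmatrix_apply, Matrix.diagonal_apply, h']
    · simp [Matrix.charmatrix_apply, Matrix.diagonal_apply, h]
  rw [Matrix.charpoly, this, Matrix.det_kronecker]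
  simp [Matrix.charpoly]

theorem poly_pow_inj {p q : Polynomial ℂ} (hp : p.Monic) (hq : q.Monic) {d : ℕ} (hd : d ≠ 0)
    (h : p ^ d = q ^ d) : p = q := by
  have hr : p.roots = q.roots := by
    have := congrArg Polynomial.roots h
    rw [Polynomial.roots_pow, Polynomial.roots_pow] at this
    exact nsmul_right_injective hd this
  rw [Polynomial.Splits.eq_prod_roots_of_monic (IsAlgClosed.splits p) hp, hr,
    ← Polynomial.Splits.eq_prod_roots_of_monic (IsAlgClosed.splits q) hq]

theorem purity_le {α β : Type*} [Fintype α] [Fintype β] [DecidableEq α] [DecidableEq β]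
    [Nonempty α] (U : Matrix (α × β) (α × β) ℂ) (hU : IsUnitary U)
    (σ ξ : Matrix β β ℂ) (hσ : σ.PosSemidef)
    (h : ∀ X : Matrix α α ℂ, trFst (U * (X ⊗ₖ σ) * Uᴴ) = X.trace • ξ) :
    (σ * σ).trace ≤ (ξ * ξ).trace := by
  obtain ⟨S, hS⟩ := psd_fact hσ
  set B := Sᴴ with hB
  have hσB : σ = B * Bᴴ := by rw [hS, hB, Matrix.conjTranspose_conjTranspose]
  clear_value B
  set G := U * ((1 : Matrix α α ℂ) ⊗ₖ B) with hG
  have hGG : Gᴴ * G = (1 : Matrix α α ℂ) ⊗ₖ (Bᴴ * B) := by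
    rw [hG, Matrix.conjTranspose_mul, Matrix.mul_assoc, ← Matrix.mul_assoc Uᴴ, hU.2,
      Matrix.one_mul, Matrix.conjTranspose_kronecker, ← Matrix.mul_kronecker_mul,
      Matrix.conjTranspose_one, Matrix.one_mul]
  have hGX : ∀ X : Matrix α α ℂ, U * (X ⊗ₖ σ) * Uᴴ = G * (X ⊗ₖ (1 : Matrix β β ℂ)) * Gᴴ := by
    intro X
    have : X ⊗ₖ σ = ((1 : Matrix α α ℂ) ⊗ₖ B) * (X ⊗ₖ (1 : Matrix β β ℂ)) *
        ((1 : Matrix α α ℂ) ⊗ₖ B)ᴴ := by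
      rw [Matrix.conjTranspose_kronecker, ← Matrix.mul_kronecker_mul, ← Matrix.mul_kronecker_mul,
        Matrix.conjTranspose_one, Matrix.one_mul, Matrix.mul_one, Matrix.mul_one, hσB]
    rw [this, hG, Matrix.conjTranspose_mul]
    simp only [Matrix.mul_assoc]
  clear_value G
  let T : Matrix (α × β) (α × β) ℂ := Matrix.of fun x y => G (x.1, y.2) (y.1, x.2)
  have h1 : trFst (T * Tᴴ) = (Fintype.card α : ℂ) • (Bᴴ * B)ᵀ := by
    ext b b'
    have e : ∀ i, (Gᴴ * G) (i, b') (i, b) = (Bᴴ * B) b' b := by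
      intro i; rw [hGG]; simp
    have : (Fintype.card α : ℂ) * (Bᴴ * B) b' b = ∑ i, (Gᴴ * G) (i, b') (i, b) := by
      simp [e]
    simp only [Matrix.smul_apply, Matrix.transpose_apply, smul_eq_mul, this]
    simp only [trFst, T, Matrix.of_apply, Matrix.mul_apply, Matrix.conjTranspose_apply,
      Fintype.sum_prod_type]
    rw [Finset.sum_comm]
    refine Finset.sum_congr rfl fun i _ => Finset.sum_congr rfl fun a _ =>
      Finset.sum_congr rfl fun k _ => mul_comm _ _
  have h2 : Tᴴ * T = (1 : Matrix α α ℂ) ⊗ₖ ξᵀ := by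
    ext ⟨i, k⟩ ⟨i', k'⟩
    have e := congrFun (congrFun (h (Matrix.single i' i 1)) k') k
    rw [hGX] at e
    have e2 : (Tᴴ * T) (i, k) (i', k') =
        trFst (G * (Matrix.single i' i (1:ℂ) ⊗ₖ (1 : Matrix β β ℂ)) * Gᴴ) k' k := by
      simp only [trFst, T, Matrix.of_apply, Matrix.mul_apply, Matrix.conjTranspose_apply,
        Fintype.sum_prod_type, Matrix.kroneckerMap_apply, Matrix.single_apply, Matrix.one_apply]
      refine Finset.sum_congr rfl fun a _ => ?_
      simp [ite_and, Finset.sum_ite_eq, mul_comm]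
    rw [e2, e]
    by_cases hi : i = i'
    · subst hi; simp
    · simp [hi, Matrix.trace_single_eq_of_ne _ _ _ (Ne.symm hi)]
  have hd : (0 : ℂ) < Fintype.card α := by exact_mod_cast Fintype.card_pos
  have hK : ((Bᴴ * B)ᵀ).IsHermitian := (Matrix.isHermitian_conjTranspose_mul_self B).transpose
  have hP : (T * Tᴴ - (1 : Matrix α α ℂ) ⊗ₖ (Bᴴ * B)ᵀ).IsHermitian :=
    (Matrix.isHermitian_mul_conjTranspose_self T).sub (one_kron_herm hK)
  have key := herm_sq_nonneg hP
  have t1 : ((T * Tᴴ) * (T * Tᴴ)).trace = Fintype.card α * (ξ * ξ).trace := by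
    have : ((T * Tᴴ) * (T * Tᴴ)) = T * (Tᴴ * T) * Tᴴ := by simp only [Matrix.mul_assoc]
    rw [this, Matrix.trace_mul_cycle, ← Matrix.trace_mul_comm, h2, ← Matrix.mul_kronecker_mul,
      Matrix.trace_kronecker, Matrix.one_mul, Matrix.trace_one, ← Matrix.transpose_mul,
      Matrix.trace_transpose]
  have t2 : ((Bᴴ * B)ᵀ * (Bᴴ * B)ᵀ).trace = (σ * σ).trace := by
    rw [← Matrix.transpose_mul, Matrix.trace_transpose, hσB]
    have : (Bᴴ * B) * (Bᴴ * B) = Bᴴ * (B * Bᴴ * B) := by simp only [Matrix.mul_assoc]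
    rw [this, Matrix.trace_mul_comm]
    simp only [Matrix.mul_assoc]
  rw [sq_expand, h1, Matrix.smul_mul, Matrix.trace_smul, t1, t2, smul_eq_mul] at key
  have key2 : 0 ≤ (Fintype.card α : ℂ) * ((ξ * ξ).trace - (σ * σ).trace) := by
    convert key using 1; ring
  have key3 := mul_nonneg (inv_nonneg.2 hd.le) key2
  rw [inv_mul_cancel_left₀ hd.ne'] at key3
  exact sub_nonneg.1 key3

theorem iso_of_const {α β : Type*} [Fintype α] [Fintype β] [DecidableEq α] [DecidableEq β]
    [Nonempty α] (U : Matrix (α × β) (α × β) ℂ) (hU : IsUnitary U)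
    (σ ξ : Matrix β β ℂ) (hσ : σ.PosSemidef) (hξ : ξ.IsHermitian)
    (h : ∀ X : Matrix α α ℂ, trFst (U * (X ⊗ₖ σ) * Uᴴ) = X.trace • ξ) :
    ∃ V : Matrix β β ℂ, IsUnitary V ∧ ξ = V * σ * Vᴴ := by
  have hle := purity_le U hU σ ξ hσ h
  have hd : (0 : ℂ) < Fintype.card α := by exact_mod_cast Fintype.card_pos
  set P := U * ((1 : Matrix α α ℂ) ⊗ₖ σ) * Uᴴ with hPdef
  have hPh : P.IsHermitian := Matrix.isHermitian_mul_mul_conjTranspose U (one_kron_herm hσ.1)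
  have hH := hPh.sub (one_kron_herm (α := α) hξ)
  have hexp := sq_expand P ξ
  have h1 := h 1
  rw [← hPdef, Matrix.trace_one] at h1
  rw [h1, pur_conj hU, ← Matrix.mul_kronecker_mul, Matrix.trace_kronecker, Matrix.one_mul,
    Matrix.trace_one, Matrix.smul_mul, Matrix.trace_smul, smul_eq_mul] at hexp
  have hexp2 : ((P - (1 : Matrix α α ℂ) ⊗ₖ ξ) * (P - (1 : Matrix α α ℂ) ⊗ₖ ξ)).trace =
      Fintype.card α * ((σ * σ).trace - (ξ * ξ).trace) := by rw [hexp]; ring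
  have h0 : ((P - (1 : Matrix α α ℂ) ⊗ₖ ξ) * (P - (1 : Matrix α α ℂ) ⊗ₖ ξ)).trace = 0 := by
    apply le_antisymm _ (herm_sq_nonneg hH)
    rw [hexp2]
    exact mul_nonpos_of_nonneg_of_nonpos hd.le (sub_nonpos.2 hle)
  have hEq : P = (1 : Matrix α α ℂ) ⊗ₖ ξ := sub_eq_zero.1 (herm_sq_zero hH h0)
  have hc : P.charpoly = ((1 : Matrix α α ℂ) ⊗ₖ σ).charpoly := by
    rw [hPdef, Matrix.charpoly_mul_comm, ← Matrix.mul_assoc, hU.2, Matrix.one_mul]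
  rw [hEq, charpoly_one_kron, charpoly_one_kron] at hc
  exact unit_equiv hσ.1 hξ (poly_pow_inj (Matrix.charpoly_monic _) (Matrix.charpoly_monic _)
    Fintype.card_ne_zero hc).symm

theorem const_of_ii {α β : Type*} [Fintype α] [Fintype β] [DecidableEq β]
    (F : Matrix α α ℂ →ₗ[ℂ] Matrix β β ℂ) (σ : Matrix β β ℂ) (hσ : σ.IsHermitian)
    (h : ∀ ρ, IsDensity ρ → ∃ W : Matrix β β ℂ, IsUnitary W ∧ F ρ = W * σ * Wᴴ)
    (ρ τ : Matrix α α ℂ) (hρ : IsDensity ρ) (hτ : IsDensity τ) : F ρ = F τ := by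
  have hs : ∀ ρ, IsDensity ρ → (F ρ).IsHermitian ∧ (F ρ * F ρ).trace = (σ * σ).trace := by
    intro ρ hρ
    obtain ⟨W, hW, e⟩ := h ρ hρ
    rw [e]
    exact ⟨Matrix.isHermitian_mul_mul_conjTranspose W hσ, pur_conj hW⟩
  have hm : IsDensity ((2⁻¹ : ℂ) • (ρ + τ)) := by
    refine ⟨(hρ.1.add hτ.1).smul (by positivity), ?_⟩
    rw [Matrix.trace_smul, Matrix.trace_add, hρ.2, hτ.2]; norm_num
  obtain ⟨a1, a2⟩ := hs ρ hρ
  obtain ⟨b1, b2⟩ := hs τ hτ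
  obtain ⟨-, c2⟩ := hs _ hm
  rw [map_smul, map_add, Matrix.smul_mul, Matrix.mul_smul, smul_smul, Matrix.trace_smul,
    Matrix.add_mul, Matrix.mul_add, Matrix.mul_add, Matrix.trace_add, Matrix.trace_add,
    Matrix.trace_add, smul_eq_mul] at c2
  refine sub_eq_zero.1 (herm_sq_zero (a1.sub b1) ?_)
  rw [Matrix.sub_mul, Matrix.mul_sub, Matrix.mul_sub, Matrix.trace_sub, Matrix.trace_sub,
    Matrix.trace_sub]
  linear_combination -4 * c2 + 2 * a2 + 2 * b2

/-- Proposition 1: equivalence of the three characterizations of catalysis. -/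
theorem stmt0 {dA dB : ℕ} (U : Matrix (Fin dA × Fin dB) (Fin dA × Fin dB) ℂ)
    (hU : IsUnitary U) (σ : Matrix (Fin dB) (Fin dB) ℂ) (hσ : IsDensity σ) :
    ((∃ V : Matrix (Fin dB) (Fin dB) ℂ, IsUnitary V ∧
        ∀ ρ : Matrix (Fin dA) (Fin dA) ℂ, IsDensity ρ →
          trFst (U * (ρ ⊗ₖ σ) * Uᴴ) = V * σ * Vᴴ) ↔
      (∀ ρ : Matrix (Fin dA) (Fin dA) ℂ, IsDensity ρ →
        ∃ W : Matrix (Fin dB) (Fin dB) ℂ, IsUnitary W ∧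
          trFst (U * (ρ ⊗ₖ σ) * Uᴴ) = W * σ * Wᴴ)) ∧
    ((∃ V : Matrix (Fin dB) (Fin dB) ℂ, IsUnitary V ∧
        ∀ ρ : Matrix (Fin dA) (Fin dA) ℂ, IsDensity ρ →
          trFst (U * (ρ ⊗ₖ σ) * Uᴴ) = V * σ * Vᴴ) ↔
      (∃ ξ : Matrix (Fin dB) (Fin dB) ℂ, IsDensity ξ ∧
        ∀ ρ : Matrix (Fin dA) (Fin dA) ℂ, IsDensity ρ →
          trFst (U * (ρ ⊗ₖ σ) * Uᴴ) = ξ)) := by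
  have i_iff_aux : ∀ V : Matrix (Fin dB) (Fin dB) ℂ, IsUnitary V → IsDensity (V * σ * Vᴴ) := by
    intro V hV
    refine ⟨hσ.1.mul_mul_conjTranspose_same V, ?_⟩
    rw [Matrix.trace_mul_cycle, hV.2, Matrix.one_mul, hσ.2]
  have one_un : IsUnitary (1 : Matrix (Fin dB) (Fin dB) ℂ) := by
    constructor <;> simp
  refine ⟨⟨?_, ?_⟩, ⟨?_, ?_⟩⟩
  · rintro ⟨V, hV, h⟩ ρ hρ
    exact ⟨V, hV, h ρ hρ⟩
  · intro h
    by_cases hex : ∃ ρ : Matrix (Fin dA) (Fin dA) ℂ, IsDensity ρ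
    · obtain ⟨ρ0, h0⟩ := hex
      obtain ⟨V, hV, e⟩ := h ρ0 h0
      refine ⟨V, hV, fun ρ hρ => ?_⟩
      rw [← e]
      exact const_of_ii (chan U σ) σ hσ.1.1 h ρ ρ0 hρ h0
    · exact ⟨1, one_un, fun ρ hρ => absurd ⟨ρ, hρ⟩ hex⟩
  · rintro ⟨V, hV, h⟩
    exact ⟨_, i_iff_aux V hV, h⟩
  · rintro ⟨ξ, hξ, h⟩
    by_cases hA : Nonempty (Fin dA)
    · obtain ⟨V, hV, e⟩ := iso_of_const U hU σ ξ hσ.1 hξ.1.1 (chan_const (chan U σ) ξ h)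
      exact ⟨V, hV, fun ρ hρ => by rw [h ρ hρ, e]⟩
    · refine ⟨1, one_un, fun ρ hρ => ?_⟩
      have hE : IsEmpty (Fin dA) := not_nonempty_iff.1 hA
      have := hρ.2
      simp [Matrix.trace] at this
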